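/- arXiv:math/0207235 — 2 statements merged into one kernel-verified Lean document; each statement's English description precedes it below -/
import Mathlib

section
/- With notation as above, the first co-Hochschild cohomology Ker(d^{(2)})/Im(d) of the symmetric Hopf algebra S(g) is isomorphic to Λ²(g), and the canonical map Ker(d^{(2)}) → Λ²(g) is given by antisymmetrization f ↦ f − f^{2,1}. -/
open TensorProduct MvPolynomial

/-- The cocommutative coproduct `Δ₀` of the symmetric Hopf algebra
`S(g) = K[X₁, …, X_n]`, with the variables primitive. -/
noncomputable def comul (K : Type*) [CommRing K] (n : ℕ) :
    MvPolynomial (Fin n) K →ₐ[K]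
      (MvPolynomial (Fin n) K ⊗[K] MvPolynomial (Fin n) K) :=
  aeval fun i => X i ⊗ₜ[K] 1 + 1 ⊗ₜ[K] X i

/-- The co-Hochschild coboundary `d(f) = Δ₀(f) − f⊗1 − 1⊗f`. -/
noncomputable def coHochschildD (K : Type*) [CommRing K] (n : ℕ) :
    MvPolynomial (Fin n) K →ₗ[K]
      (MvPolynomial (Fin n) K ⊗[K] MvPolynomial (Fin n) K) :=
  (comul K n).toLinearMap -
    (Algebra.TensorProduct.includeLeft :
      MvPolynomial (Fin n) K →ₐ[K]
        MvPolynomial (Fin n) K ⊗[K] MvPolynomial (Fin n) K).toLinearMap -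
    (Algebra.TensorProduct.includeRight :
      MvPolynomial (Fin n) K →ₐ[K]
        MvPolynomial (Fin n) K ⊗[K] MvPolynomial (Fin n) K).toLinearMap

/-- `d ⊗ id`, landing in `P ⊗ (P ⊗ P)`. -/
noncomputable def dTensorId (K : Type*) [CommRing K] (n : ℕ) :
    (MvPolynomial (Fin n) K ⊗[K] MvPolynomial (Fin n) K) →ₗ[K]
      (MvPolynomial (Fin n) K ⊗[K]
        (MvPolynomial (Fin n) K ⊗[K] MvPolynomial (Fin n) K)) :=
  (TensorProduct.assoc K (MvPolynomial (Fin n) K) (MvPolynomial (Fin n) K)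
      (MvPolynomial (Fin n) K)).toLinearMap ∘ₗ
    LinearMap.rTensor (MvPolynomial (Fin n) K) (coHochschildD K n)

/-- `id ⊗ d`, landing in `P ⊗ (P ⊗ P)`. -/
noncomputable def idTensorD (K : Type*) [CommRing K] (n : ℕ) :
    (MvPolynomial (Fin n) K ⊗[K] MvPolynomial (Fin n) K) →ₗ[K]
      (MvPolynomial (Fin n) K ⊗[K]
        (MvPolynomial (Fin n) K ⊗[K] MvPolynomial (Fin n) K)) :=
  LinearMap.lTensor (MvPolynomial (Fin n) K) (coHochschildD K n)

/-- `Ker(d⁽²⁾)`, the 1-cocycles: the locus where `d⊗id` and `id⊗d` agree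
(`d⁽²⁾(F) = (d⊗id)(F) − (id⊗d)(F)`). -/
noncomputable def kerD2 (K : Type*) [CommRing K] (n : ℕ) :
    Submodule K (MvPolynomial (Fin n) K ⊗[K] MvPolynomial (Fin n) K) :=
  LinearMap.eqLocus (dTensorId K n) (idTensorD K n)

/-- A model for `Λ²(g)`: the antisymmetric part of `g ⊗ g ⊂ S(g) ⊗ S(g)`, i.e. the
elements of `g ⊗ g` on which the flip acts by `−1`. -/
noncomputable def lambdaTwo (K : Type*) [CommRing K] (n : ℕ) :
    Submodule K (MvPolynomial (Fin n) K ⊗[K] MvPolynomial (Fin n) K) :=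
  (Submodule.map₂ (TensorProduct.mk K (MvPolynomial (Fin n) K) (MvPolynomial (Fin n) K))
      (Submodule.span K (Set.range (X : Fin n → MvPolynomial (Fin n) K)))
      (Submodule.span K (Set.range (X : Fin n → MvPolynomial (Fin n) K)))) ⊓
    LinearMap.eqLocus
      ((TensorProduct.comm K (MvPolynomial (Fin n) K) (MvPolynomial (Fin n) K)).toLinearMap)
      (-(LinearMap.id : (MvPolynomial (Fin n) K ⊗[K] MvPolynomial (Fin n) K) →ₗ[K]
          (MvPolynomial (Fin n) K ⊗[K] MvPolynomial (Fin n) K)))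

/-- If `T` is diagonal in the basis `b`, with weights `w`, then every eigenvector of `T` for the
eigenvalue `c` is a combination of the basis vectors of weight `c`. -/
theorem Module.Basis.mem_span_of_diagonal {ι K M : Type*} [Field K] [AddCommGroup M] [Module K M]
    (b : Module.Basis ι K M) (T : M →ₗ[K] M) (w : ι → K) (hT : ∀ i, T (b i) = w i • b i)
    {c : K} {m : M} (hm : T m = c • m) :
    m ∈ Submodule.span K (b '' {i | w i = c}) := by
  refine Submodule.span_mono (Set.image_mono fun i hi => ?_) (b.mem_span_repr_support m)
  have key : b.coord i ∘ₗ T = w i • b.coord i := b.ext fun j => by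
    by_cases h : j = i
    · subst h; simp [hT]
    · simp [hT, h]
  have h₁ := LinearMap.congr_fun key m
  rw [LinearMap.comp_apply, hm] at h₁
  simp only [map_smul, LinearMap.smul_apply, Module.Basis.coord_apply, smul_eq_mul] at h₁
  exact (mul_right_cancel₀ (Finsupp.mem_support_iff.mp hi) h₁).symm

theorem two_pow_eq_two_iff {K : Type*} [Field K] [CharZero K] {m : ℕ} :
    (2 : K) ^ m = 2 ↔ m = 1 := by
  refine ⟨fun h => ?_, fun h => by simp [h]⟩
  have h' : 2 ^ m = 2 ^ 1 := by exact_mod_cast h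
  exact Nat.pow_right_injective le_rfl h'

namespace MvPolynomial

section Rescale

variable {σ K : Type*} [Field K]

/-- The substitution `X i ↦ 2 X i`. -/
noncomputable def double (σ K : Type*) [Field K] : MvPolynomial σ K →ₐ[K] MvPolynomial σ K :=
  aeval fun i => (2 : K) • X i

theorem double_monomial (a : σ →₀ ℕ) :
    double σ K (monomial a 1) = (2 : K) ^ a.degree • monomial a 1 := by
  rw [double, aeval_monomial, monomial_eq]
  simp only [smul_pow, map_one, one_mul, Finsupp.prod, Finset.prod_smul,
    Finset.prod_pow_eq_pow_sum, Finsupp.degree_apply]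

theorem aeval_double (x : σ → K) (p : MvPolynomial σ K) :
    aeval x (double σ K p) = aeval ((2 : K) • x) p := by
  suffices h : (aeval x).comp (double σ K) = aeval ((2 : K) • x) from DFunLike.congr_fun h p
  ext i
  simp [double]

/-- A partial inverse of `double - 2`: it divides the monomials of degree `m` by `2 ^ m - 2`, and
annihilates those of degree one. -/
noncomputable def divDouble (σ K : Type*) [Field K] : MvPolynomial σ K →ₗ[K] MvPolynomial σ K :=
  (basisMonomials σ K).constr K fun a => ((2 : K) ^ a.degree - 2)⁻¹ • monomial a 1

theorem divDouble_monomial (a : σ →₀ ℕ) :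
    divDouble σ K (monomial a 1) = ((2 : K) ^ a.degree - 2)⁻¹ • monomial a 1 := by
  have h := (basisMonomials σ K).constr_basis K
    (fun a => ((2 : K) ^ a.degree - 2)⁻¹ • monomial a (1 : K)) a
  rwa [coe_basisMonomials] at h

end Rescale

variable {n : ℕ} {K : Type*} [Field K]

/-- Evaluation of the two tensor factors at the points `x` and `y`. -/
noncomputable def evalTwo (x y : Fin n → K) :
    MvPolynomial (Fin n) K ⊗[K] MvPolynomial (Fin n) K →ₐ[K] K :=
  Algebra.TensorProduct.lift (aeval x) (aeval y) fun _ _ => Commute.all _ _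

@[simp]
theorem evalTwo_tmul (x y : Fin n → K) (p q : MvPolynomial (Fin n) K) :
    evalTwo x y (p ⊗ₜ q) = aeval x p * aeval y q := by
  simp [evalTwo]

theorem evalTwo_ext [CharZero K] {F G : MvPolynomial (Fin n) K ⊗[K] MvPolynomial (Fin n) K}
    (h : ∀ x y : Fin n → K, evalTwo x y F = evalTwo x y G) : F = G := by
  apply (tensorEquivSum K (Fin n) (Fin n) K).injective
  apply MvPolynomial.funext
  intro z
  have key : ((aeval z : MvPolynomial (Fin n ⊕ Fin n) K →ₐ[K] K).comp
      (tensorEquivSum K (Fin n) (Fin n) K).toAlgHom) = evalTwo (z ∘ Sum.inl) (z ∘ Sum.inr) := by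
    ext i <;> simp
  have h' : ∀ H, eval z (tensorEquivSum K (Fin n) (Fin n) K H) =
      evalTwo (z ∘ Sum.inl) (z ∘ Sum.inr) H := fun H => by
    rw [← key]; simp [aeval_eq_eval]
  rw [h', h', h]

theorem evalTwo_comm (x y : Fin n → K)
    (F : MvPolynomial (Fin n) K ⊗[K] MvPolynomial (Fin n) K) :
    evalTwo x y (TensorProduct.comm K _ _ F) = evalTwo y x F := by
  induction F using TensorProduct.induction_on with
  | zero => simp
  | tmul p q => simp [mul_comm]
  | add F G hF hG => rw [map_add, map_add, hF, hG, map_add]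

theorem evalTwo_map_double_left (x y : Fin n → K)
    (F : MvPolynomial (Fin n) K ⊗[K] MvPolynomial (Fin n) K) :
    evalTwo x y (LinearMap.rTensor _ (double (Fin n) K).toLinearMap F) =
      evalTwo ((2 : K) • x) y F := by
  induction F using TensorProduct.induction_on with
  | zero => simp
  | tmul p q => simp [aeval_double]
  | add F G hF hG => rw [map_add, map_add, hF, hG, map_add]

theorem evalTwo_map_double_right (x y : Fin n → K)
    (F : MvPolynomial (Fin n) K ⊗[K] MvPolynomial (Fin n) K) :
    evalTwo x y (LinearMap.lTensor _ (double (Fin n) K).toLinearMap F) =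
      evalTwo x ((2 : K) • y) F := by
  induction F using TensorProduct.induction_on with
  | zero => simp
  | tmul p q => simp [aeval_double]
  | add F G hF hG => rw [map_add, map_add, hF, hG, map_add]

theorem aeval_lmul' (x : Fin n → K)
    (F : MvPolynomial (Fin n) K ⊗[K] MvPolynomial (Fin n) K) :
    aeval x (Algebra.TensorProduct.lmul' K F) = evalTwo x x F := by
  induction F using TensorProduct.induction_on with
  | zero => simp
  | tmul p q => simp
  | add F G hF hG => rw [map_add, map_add, hF, hG, map_add]

/-- Evaluation of the three tensor factors at the points `x`, `y` and `z`. -/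
noncomputable def evalThree (x y z : Fin n → K) :
    MvPolynomial (Fin n) K ⊗[K] (MvPolynomial (Fin n) K ⊗[K] MvPolynomial (Fin n) K) →ₐ[K] K :=
  Algebra.TensorProduct.lift (aeval x) (evalTwo y z) fun _ _ => Commute.all _ _

@[simp]
theorem evalThree_tmul (x y z : Fin n → K) (p : MvPolynomial (Fin n) K)
    (F : MvPolynomial (Fin n) K ⊗[K] MvPolynomial (Fin n) K) :
    evalThree x y z (p ⊗ₜ F) = aeval x p * evalTwo y z F := by
  simp [evalThree]

theorem evalThree_assoc_tmul (x y z : Fin n → K) (q : MvPolynomial (Fin n) K)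
    (F : MvPolynomial (Fin n) K ⊗[K] MvPolynomial (Fin n) K) :
    evalThree x y z (TensorProduct.assoc K _ _ _ (F ⊗ₜ q)) = evalTwo x y F * aeval z q := by
  induction F using TensorProduct.induction_on with
  | zero => simp
  | tmul p q => simp [mul_assoc]
  | add F G hF hG => rw [TensorProduct.add_tmul, map_add, map_add, hF, hG, map_add, add_mul]

theorem evalTwo_comul (x y : Fin n → K) (p : MvPolynomial (Fin n) K) :
    evalTwo x y (comul K n p) = aeval (x + y) p := by
  suffices h : (evalTwo x y).comp (comul K n) = aeval (x + y) from DFunLike.congr_fun h p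
  ext i
  simp [comul]

theorem evalTwo_coHochschildD (x y : Fin n → K) (p : MvPolynomial (Fin n) K) :
    evalTwo x y (coHochschildD K n p) = aeval (x + y) p - aeval x p - aeval y p := by
  simp [coHochschildD, evalTwo_comul]

theorem coHochschildD_X (i : Fin n) : coHochschildD K n (X i) = 0 := by
  simp [coHochschildD, comul]

theorem evalThree_dTensorId (x y z : Fin n → K)
    (F : MvPolynomial (Fin n) K ⊗[K] MvPolynomial (Fin n) K) :
    evalThree x y z (dTensorId K n F) =
      evalTwo (x + y) z F - evalTwo x z F - evalTwo y z F := by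
  induction F using TensorProduct.induction_on with
  | zero => simp
  | tmul p q =>
    simp only [dTensorId, LinearMap.comp_apply, LinearMap.rTensor_tmul, LinearEquiv.coe_coe,
      evalThree_assoc_tmul, evalTwo_coHochschildD, evalTwo_tmul]
    ring
  | add F G hF hG => simp only [map_add, hF, hG]; ring

theorem evalThree_idTensorD (x y z : Fin n → K)
    (F : MvPolynomial (Fin n) K ⊗[K] MvPolynomial (Fin n) K) :
    evalThree x y z (idTensorD K n F) =
      evalTwo x (y + z) F - evalTwo x y F - evalTwo x z F := by
  induction F using TensorProduct.induction_on with
  | zero => simp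
  | tmul p q =>
    simp only [idTensorD, LinearMap.lTensor_tmul, evalThree_tmul, evalTwo_coHochschildD,
      evalTwo_tmul]
    ring
  | add F G hF hG => simp only [map_add, hF, hG]; ring

theorem evalTwo_cocycle {F : MvPolynomial (Fin n) K ⊗[K] MvPolynomial (Fin n) K}
    (hF : F ∈ kerD2 K n) (x y z : Fin n → K) :
    evalTwo (x + y) z F + evalTwo x y F = evalTwo x (y + z) F + evalTwo y z F := by
  have h := congrArg (evalThree x y z) (LinearMap.mem_eqLocus.mp hF)
  rw [evalThree_dTensorId, evalThree_idTensorD] at h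
  linear_combination h

/-- The monomial basis of the tensor square. -/
noncomputable def basisTwo (K : Type*) [Field K] (n : ℕ) :
    Module.Basis ((Fin n →₀ ℕ) × (Fin n →₀ ℕ)) K
      (MvPolynomial (Fin n) K ⊗[K] MvPolynomial (Fin n) K) :=
  (basisMonomials (Fin n) K).tensorProduct (basisMonomials (Fin n) K)

theorem basisTwo_apply (i : (Fin n →₀ ℕ) × (Fin n →₀ ℕ)) :
    basisTwo K n i = monomial i.1 1 ⊗ₜ monomial i.2 1 := by
  simp [basisTwo, Module.Basis.tensorProduct_apply']

theorem exists_monomial_eq_X {a : Fin n →₀ ℕ} (ha : a.degree = 1) :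
    ∃ i, monomial a (1 : K) = X i := by
  obtain ⟨i, rfl⟩ : a ∈ Set.range (fun i : Fin n => Finsupp.single i 1) := by
    rw [Finsupp.range_single_one]; exact ha
  exact ⟨i, rfl⟩

theorem lambdaTwo_le_kerD2 : lambdaTwo K n ≤ kerD2 K n := by
  refine inf_le_left.trans ?_
  have hX : ∀ p ∈ Submodule.span K (Set.range (X : Fin n → MvPolynomial (Fin n) K)),
      coHochschildD K n p = 0 := fun p hp => by
    have : Submodule.span K (Set.range (X : Fin n → MvPolynomial (Fin n) K)) ≤
        LinearMap.ker (coHochschildD K n) := by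
      rw [Submodule.span_le]
      rintro _ ⟨i, rfl⟩
      exact coHochschildD_X i
    exact this hp
  rw [Submodule.map₂_le]
  intro p hp q hq
  refine LinearMap.mem_eqLocus.mpr ?_
  simp [dTensorId, idTensorD, hX p hp, hX q hq]

variable [CharZero K]

theorem mem_map₂_span_X_of_additive
    {F : MvPolynomial (Fin n) K ⊗[K] MvPolynomial (Fin n) K}
    (hl : ∀ x y z : Fin n → K, evalTwo (x + y) z F = evalTwo x z F + evalTwo y z F)
    (hr : ∀ x y z : Fin n → K, evalTwo x (y + z) F = evalTwo x y F + evalTwo x z F) :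
    F ∈ Submodule.map₂ (TensorProduct.mk K (MvPolynomial (Fin n) K) (MvPolynomial (Fin n) K))
      (Submodule.span K (Set.range (X : Fin n → MvPolynomial (Fin n) K)))
      (Submodule.span K (Set.range (X : Fin n → MvPolynomial (Fin n) K))) := by
  have h₁ := (basisTwo K n).mem_span_of_diagonal
    (LinearMap.rTensor _ (double (Fin n) K).toLinearMap) (fun i => 2 ^ i.1.degree)
    (fun i => by simp [basisTwo_apply, double_monomial, TensorProduct.smul_tmul'])
    (c := 2) (m := F) (evalTwo_ext fun x y => by
      rw [evalTwo_map_double_left, two_smul, hl, map_smul, smul_eq_mul, two_mul])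
  have h₂ := (basisTwo K n).mem_span_of_diagonal
    (LinearMap.lTensor _ (double (Fin n) K).toLinearMap) (fun i => 2 ^ i.2.degree)
    (fun i => by simp [basisTwo_apply, double_monomial])
    (c := 2) (m := F) (evalTwo_ext fun x y => by
      rw [evalTwo_map_double_right, two_smul, hr, map_smul, smul_eq_mul, two_mul])
  rw [Module.Basis.mem_span_image] at h₁ h₂
  refine Submodule.span_le.mpr ?_ ((basisTwo K n).mem_span_repr_support F)
  rintro _ ⟨i, hi, rfl⟩
  obtain ⟨j, hj⟩ := exists_monomial_eq_X (K := K) (two_pow_eq_two_iff.mp (h₁ hi))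
  obtain ⟨k, hk⟩ := exists_monomial_eq_X (K := K) (two_pow_eq_two_iff.mp (h₂ hi))
  rw [basisTwo_apply, hj, hk]
  exact Submodule.apply_mem_map₂ _ (Submodule.subset_span ⟨j, rfl⟩)
    (Submodule.subset_span ⟨k, rfl⟩)

theorem sub_comm_mem_lambdaTwo {F : MvPolynomial (Fin n) K ⊗[K] MvPolynomial (Fin n) K}
    (hF : F ∈ kerD2 K n) :
    F - TensorProduct.comm K (MvPolynomial (Fin n) K) (MvPolynomial (Fin n) K) F ∈
      lambdaTwo K n := by
  have hc := evalTwo_cocycle hF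
  refine ⟨mem_map₂_span_X_of_additive (fun x y z => ?_) (fun x y z => ?_), ?_⟩
  · simp only [map_sub, evalTwo_comm]
    have h := hc x z y
    rw [add_comm z y] at h
    have h' := hc z x y
    rw [add_comm z x] at h'
    linear_combination hc x y z - h + h'
  · simp only [map_sub, evalTwo_comm]
    have h := hc y x z
    rw [add_comm y x] at h
    have h' := hc y z x
    rw [add_comm z x] at h'
    linear_combination -hc x y z + h - h'
  · refine LinearMap.mem_eqLocus.mpr (evalTwo_ext fun x y => ?_)
    simp [evalTwo_comm]

theorem eq_zero_of_cocycle_of_homogeneous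
    {F : MvPolynomial (Fin n) K ⊗[K] MvPolynomial (Fin n) K}
    (hc : ∀ x y z : Fin n → K,
      evalTwo (x + y) z F + evalTwo x y F = evalTwo x (y + z) F + evalTwo y z F)
    (hd : ∀ x y : Fin n → K, evalTwo ((2 : K) • x) ((2 : K) • y) F = 2 * evalTwo x y F) : F = 0 := by
  have h₁ := (basisTwo K n).mem_span_of_diagonal
    (LinearMap.rTensor _ (double (Fin n) K).toLinearMap ∘ₗ
      LinearMap.lTensor _ (double (Fin n) K).toLinearMap) (fun i => 2 ^ (i.1.degree + i.2.degree))
    (fun i => by simp [basisTwo_apply, double_monomial, ← TensorProduct.smul_tmul', smul_smul,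
      pow_add, mul_comm])
    (c := 2) (m := F) (evalTwo_ext fun x y => by
      rw [LinearMap.comp_apply, evalTwo_map_double_left, evalTwo_map_double_right, hd, map_smul,
        smul_eq_mul])
  have h₂ : ∀ x y : Fin n → K, evalTwo x y F = evalTwo x 0 F + evalTwo 0 y F := fun x y => by
    refine LinearMap.eqOn_span (f := (evalTwo x y).toLinearMap)
      (g := (evalTwo x 0).toLinearMap + (evalTwo 0 y).toLinearMap) ?_ h₁
    rintro _ ⟨i, hi, rfl⟩
    have hi' := two_pow_eq_two_iff.mp hi
    rcases Nat.add_eq_one_iff.mp hi' with ⟨ha, hb⟩ | ⟨ha, hb⟩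
    · obtain ⟨k, hk⟩ := exists_monomial_eq_X (K := K) hb
      rw [basisTwo_apply, (Finsupp.degree_eq_zero_iff _).mp ha, hk]
      simp
    · obtain ⟨k, hk⟩ := exists_monomial_eq_X (K := K) ha
      rw [basisTwo_apply, (Finsupp.degree_eq_zero_iff _).mp hb, hk]
      simp
  have h₀ : evalTwo (0 : Fin n → K) 0 F = 0 := by simpa using h₂ 0 0
  refine evalTwo_ext fun x y => ?_
  have hx := hc x 0 0
  have hy := hc 0 0 y
  simp only [add_zero, zero_add, h₀] at hx hy
  rw [h₂, map_zero]
  linear_combination hx - hy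

theorem coHochschildD_double_divDouble (p : MvPolynomial (Fin n) K) :
    coHochschildD K n (double (Fin n) K (divDouble (Fin n) K p)) -
      (2 : K) • coHochschildD K n (divDouble (Fin n) K p) = coHochschildD K n p := by
  suffices h : coHochschildD K n ∘ₗ (double (Fin n) K).toLinearMap ∘ₗ divDouble (Fin n) K -
      (2 : K) • (coHochschildD K n ∘ₗ divDouble (Fin n) K) = coHochschildD K n from
    LinearMap.congr_fun h p
  refine (basisMonomials (Fin n) K).ext fun a => ?_
  rw [coe_basisMonomials]
  simp only [LinearMap.sub_apply, LinearMap.comp_apply, LinearMap.smul_apply,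
    divDouble_monomial, map_smul, AlgHom.toLinearMap_apply, double_monomial, smul_smul]
  by_cases ha : a.degree = 1
  · obtain ⟨i, hi⟩ := exists_monomial_eq_X (K := K) ha
    simp [hi, coHochschildD_X]
  · have hne : (2 : K) ^ a.degree - 2 ≠ 0 := sub_ne_zero.mpr (mt two_pow_eq_two_iff.mp ha)
    refine (sub_smul _ _ _).symm.trans ?_
    convert one_smul K _
    field_simp

theorem mem_range_coHochschildD_of_symmetric
    {F : MvPolynomial (Fin n) K ⊗[K] MvPolynomial (Fin n) K} (hF : F ∈ kerD2 K n)
    (hs : TensorProduct.comm K (MvPolynomial (Fin n) K) (MvPolynomial (Fin n) K) F = F) :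
    F ∈ LinearMap.range (coHochschildD K n) := by
  have hc := evalTwo_cocycle hF
  have hs' : ∀ x y : Fin n → K, evalTwo x y F = evalTwo y x F := fun x y => by
    rw [← evalTwo_comm, hs]
  set p := Algebra.TensorProduct.lmul' K F with hp
  set h := divDouble (Fin n) K p with hh
  have hdouble : ∀ x y : Fin n → K, evalTwo ((2 : K) • x) ((2 : K) • y) (coHochschildD K n h) -
      2 * evalTwo x y (coHochschildD K n h) =
        evalTwo (x + y) (x + y) F - evalTwo x x F - evalTwo y y F := fun x y => by
    have := congrArg (evalTwo x y) (coHochschildD_double_divDouble p)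
    rw [← hh] at this
    simp only [map_sub, map_smul, evalTwo_coHochschildD, aeval_double, hp, aeval_lmul',
      smul_eq_mul, smul_add] at this
    simpa only [evalTwo_coHochschildD] using this
  refine ⟨h, sub_eq_zero.mp (eq_zero_of_cocycle_of_homogeneous (fun x y z => ?_) fun x y => ?_)⟩
  · simp only [map_sub, evalTwo_coHochschildD, ← add_assoc]
    linear_combination -hc x y z
  · have h₁ := hc x y (x + y)
    have h₂ := hc y y x
    have h₃ := hc x x (y + y)
    have h₄ : x + (y + y) = y + (x + y) := by abel
    rw [h₄] at h₃
    rw [add_comm y x] at h₂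
    simp only [map_sub]
    have h₅ := hdouble x y
    simp only [two_smul] at h₅ ⊢
    linear_combination h₅ + h₁ - h₂ - h₃ + hs' x y - hs' x (y + y)

theorem comm_coHochschildD (p : MvPolynomial (Fin n) K) :
    TensorProduct.comm K (MvPolynomial (Fin n) K) (MvPolynomial (Fin n) K)
      (coHochschildD K n p) = coHochschildD K n p := by
  refine evalTwo_ext fun x y => ?_
  rw [evalTwo_comm, evalTwo_coHochschildD, evalTwo_coHochschildD, add_comm]
  ring

end MvPolynomial

/-- The first co-Hochschild cohomology `Ker(d⁽²⁾)/Im(d)` of the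
symmetric Hopf algebra `S(g)` of a finite-dimensional vector space `g` (over a field of
characteristic `0`) is isomorphic to `Λ²(g)` — realized here as the antisymmetric part
of `g ⊗ g` — and the canonical map `Ker(d⁽²⁾) → Λ²(g)` is the antisymmetrization
`f ↦ f − f^{2,1}`.  (We phrase the isomorphism `Ker(d⁽²⁾)/Im(d) ≅ Λ²(g)` via the first
isomorphism theorem: the antisymmetrization is a surjective linear map
`Ker(d⁽²⁾) → Λ²(g)` whose kernel is exactly `Im(d)`.) -/
theorem firstCoHochschildCohomology_iso_lambdaTwo
    (K : Type*) [Field K] [CharZero K] (n : ℕ) :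
    ∃ φ : kerD2 K n →ₗ[K] lambdaTwo K n,
      (∀ (f : MvPolynomial (Fin n) K ⊗[K] MvPolynomial (Fin n) K) (hf : f ∈ kerD2 K n),
        (φ ⟨f, hf⟩ : MvPolynomial (Fin n) K ⊗[K] MvPolynomial (Fin n) K) =
          f - (TensorProduct.comm K (MvPolynomial (Fin n) K)
              (MvPolynomial (Fin n) K)) f) ∧
      Function.Surjective φ ∧
      LinearMap.ker φ =
        (LinearMap.range (coHochschildD K n)).comap (kerD2 K n).subtype := by
  refine ⟨LinearMap.codRestrict (lambdaTwo K n)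
    ((LinearMap.id - (TensorProduct.comm K (MvPolynomial (Fin n) K)
      (MvPolynomial (Fin n) K)).toLinearMap) ∘ₗ (kerD2 K n).subtype)
    fun f => sub_comm_mem_lambdaTwo f.2, fun f hf => rfl, ?_, ?_⟩
  · rintro ⟨g, hg⟩
    refine ⟨⟨(2 : K)⁻¹ • g, Submodule.smul_mem _ _ (lambdaTwo_le_kerD2 hg)⟩, Subtype.ext ?_⟩
    have hg' : TensorProduct.comm K (MvPolynomial (Fin n) K) (MvPolynomial (Fin n) K) g = -g :=
      LinearMap.mem_eqLocus.mp hg.2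
    change (2 : K)⁻¹ • g - TensorProduct.comm K _ _ ((2 : K)⁻¹ • g) = g
    rw [map_smul, hg', smul_neg, sub_neg_eq_add, ← two_smul K, smul_smul,
      mul_inv_cancel₀ two_ne_zero, one_smul]
  · ext ⟨f, hf⟩
    rw [LinearMap.mem_ker, ← Subtype.coe_inj]
    change f - TensorProduct.comm K _ _ f = 0 ↔ f ∈ LinearMap.range (coHochschildD K n)
    refine ⟨fun h => mem_range_coHochschildD_of_symmetric hf (sub_eq_zero.mp h).symm, ?_⟩
    rintro ⟨p, rfl⟩
    rw [comm_coHochschildD, sub_self]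
end

section
/- Let g be a finite-dimensional vector space, n ≥ 2, and let σ ∈ S^{n}(g⊕g) ≅ ⊕_{a+b=n, a,b≥1} S^a(g)⊗S^b(g) (i.e., with trivial components for a=0 or b=0) satisfy (Δ₀⊗id)(σ) = σ^{1,3} + σ^{2,3} and (id⊗Δ₀)(σ) = σ^{1,3} + σ^{1,2}. Then σ ∈ g ⊗ S^{n-1}(g) and σ ∈ S^{n-1}(g) ⊗ g; hence if n ≥ 3, σ = 0. -/
open TensorProduct MvPolynomial

/-- The part `⊕_{a+b=m, a,b ≥ 1} S^a(g) ⊗ S^b(g)` of the degree-`m` component of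
`S(g) ⊗ S(g)` with both tensor factors of positive degree. -/
noncomputable def degreeComponentPos2 (K : Type*) [CommRing K] (n : ℕ) (m : ℕ) :
    Submodule K (MvPolynomial (Fin n) K ⊗[K] MvPolynomial (Fin n) K) :=
  ⨆ (p : ℕ × ℕ) (_ : p.1 + p.2 = m ∧ 1 ≤ p.1 ∧ 1 ≤ p.2),
    Submodule.map₂ (TensorProduct.mk K (MvPolynomial (Fin n) K) (MvPolynomial (Fin n) K))
      (homogeneousSubmodule (Fin n) K p.1) (homogeneousSubmodule (Fin n) K p.2)

/-- Multiplying out the coproduct of a monomial scales it by `2` to its degree. -/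
lemma lmul'_comul_monomial (K : Type*) [CommRing K] (n : ℕ) (s : Fin n →₀ ℕ) :
    Algebra.TensorProduct.lmul' K (comul K n (monomial s 1)) =
      (2 : K) ^ s.degree • (monomial s 1 : MvPolynomial (Fin n) K) := by
  have h : (Algebra.TensorProduct.lmul' K).comp (comul K n) =
      aeval fun i => (2 : K) • (X i : MvPolynomial (Fin n) K) := by
    ext1 i
    simp [comul, two_smul]
  have h' := DFunLike.congr_fun h (monomial s 1)
  rw [AlgHom.comp_apply] at h'
  rw [h', aeval_monomial, map_one, one_mul]
  simp only [Finsupp.prod, smul_pow, Finset.prod_smul, prod_X_pow_eq_monomial,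
    Finset.prod_pow_eq_pow_sum, Finsupp.degree]
  rfl

/-- Multiplying out the co-Hochschild coboundary scales a monomial of degree `a` by `2 ^ a - 2`. -/
lemma mul'_coHochschildD_monomial (K : Type*) [CommRing K] (n : ℕ) (s : Fin n →₀ ℕ) :
    LinearMap.mul' K (MvPolynomial (Fin n) K) (coHochschildD K n (monomial s 1)) =
      ((2 : K) ^ s.degree - 2) • (monomial s 1 : MvPolynomial (Fin n) K) := by
  have h := lmul'_comul_monomial K n s
  rw [← AlgHom.toLinearMap_apply, Algebra.TensorProduct.lmul'_toLinearMap] at h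
  simp [coHochschildD, h, sub_smul, two_smul, sub_sub]

lemma two_pow_sub_two_ne_zero (K : Type*) [Field K] [CharZero K] {a : ℕ} (ha : a ≠ 1) :
    (2 : K) ^ a - 2 ≠ 0 := by
  rw [sub_ne_zero]
  intro h
  have hpow : 2 ^ a = 2 ^ 1 := by exact_mod_cast h
  exact ha (Nat.pow_right_injective le_rfl hpow)

/-- The co-Hochschild coboundary is split injective away from degree one. -/
lemma exists_comp_coHochschildD_eq (K : Type*) [Field K] [CharZero K] (n : ℕ) :
    ∃ G : MvPolynomial (Fin n) K ⊗[K] MvPolynomial (Fin n) K →ₗ[K] MvPolynomial (Fin n) K,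
      G ∘ₗ coHochschildD K n = LinearMap.id - homogeneousComponent 1 := by
  refine ⟨(basisMonomials (Fin n) K).constr K
    (fun s => ((2 : K) ^ s.degree - 2)⁻¹ • monomial s 1) ∘ₗ LinearMap.mul' K _, ?_⟩
  refine (basisMonomials (Fin n) K).ext fun s => ?_
  have hc := (basisMonomials (Fin n) K).constr_basis K
    (fun s => ((2 : K) ^ s.degree - 2)⁻¹ • (monomial s 1 : MvPolynomial (Fin n) K)) s
  rw [coe_basisMonomials] at hc ⊢
  rw [LinearMap.comp_apply, LinearMap.comp_apply, mul'_coHochschildD_monomial, map_smul, hc,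
    LinearMap.sub_apply, LinearMap.id_apply,
    homogeneousComponent_of_mem (isHomogeneous_monomial (1 : K) (rfl : s.degree = s.degree))]
  split_ifs with h
  · simp [← h]
  · rw [smul_smul, mul_inv_cancel₀ (two_pow_sub_two_ne_zero K (Ne.symm h)), one_smul, sub_zero]

lemma rTensor_homogeneousComponent_one_of_dTensorId_eq_zero {K : Type*} [Field K] [CharZero K]
    {n : ℕ} {σ : MvPolynomial (Fin n) K ⊗[K] MvPolynomial (Fin n) K}
    (h : dTensorId K n σ = 0) :
    (homogeneousComponent 1).rTensor (MvPolynomial (Fin n) K) σ = σ := by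
  obtain ⟨G, hG⟩ := exists_comp_coHochschildD_eq K n
  have h' : (coHochschildD K n).rTensor (MvPolynomial (Fin n) K) σ = 0 := by
    simpa [dTensorId] using h
  have h₂ := congrArg (G.rTensor (MvPolynomial (Fin n) K)) h'
  rw [← LinearMap.rTensor_comp_apply, hG, LinearMap.rTensor_sub, map_zero,
    LinearMap.sub_apply, LinearMap.rTensor_id_apply, sub_eq_zero] at h₂
  exact h₂.symm

lemma lTensor_homogeneousComponent_one_of_idTensorD_eq_zero {K : Type*} [Field K] [CharZero K]
    {n : ℕ} {σ : MvPolynomial (Fin n) K ⊗[K] MvPolynomial (Fin n) K}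
    (h : idTensorD K n σ = 0) :
    (homogeneousComponent 1).lTensor (MvPolynomial (Fin n) K) σ = σ := by
  obtain ⟨G, hG⟩ := exists_comp_coHochschildD_eq K n
  have h₂ := congrArg (G.lTensor (MvPolynomial (Fin n) K)) h
  rw [idTensorD, ← LinearMap.lTensor_comp_apply, hG, LinearMap.lTensor_sub, map_zero,
    LinearMap.sub_apply, LinearMap.lTensor_id_apply, sub_eq_zero] at h₂
  exact h₂.symm

lemma rTensor_homogeneousComponent_one_mem {K : Type*} [CommRing K] {n m : ℕ}
    {σ : MvPolynomial (Fin n) K ⊗[K] MvPolynomial (Fin n) K}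
    (hσ : σ ∈ degreeComponentPos2 K n m) :
    (homogeneousComponent 1).rTensor (MvPolynomial (Fin n) K) σ ∈
      Submodule.map₂ (TensorProduct.mk K (MvPolynomial (Fin n) K) (MvPolynomial (Fin n) K))
        (homogeneousSubmodule (Fin n) K 1) (homogeneousSubmodule (Fin n) K (m - 1)) := by
  rw [← Submodule.mem_comap]
  refine (iSup₂_le fun p hp => Submodule.map₂_le.2 fun x hx y hy => ?_ :
    degreeComponentPos2 K n m ≤ _) hσ
  rw [Submodule.mem_comap, TensorProduct.mk_apply, LinearMap.rTensor_tmul,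
    homogeneousComponent_of_mem hx]
  split_ifs with h
  · rw [← h] at hx
    have hy' : y ∈ homogeneousSubmodule (Fin n) K (m - 1) := by
      rwa [show m - 1 = p.2 by omega]
    exact Submodule.apply_mem_map₂ _ hx hy'
  · rw [TensorProduct.zero_tmul]
    exact zero_mem _

lemma lTensor_homogeneousComponent_one_mem {K : Type*} [CommRing K] {n m : ℕ}
    {σ : MvPolynomial (Fin n) K ⊗[K] MvPolynomial (Fin n) K}
    (hσ : σ ∈ degreeComponentPos2 K n m) :
    (homogeneousComponent 1).lTensor (MvPolynomial (Fin n) K) σ ∈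
      Submodule.map₂ (TensorProduct.mk K (MvPolynomial (Fin n) K) (MvPolynomial (Fin n) K))
        (homogeneousSubmodule (Fin n) K (m - 1)) (homogeneousSubmodule (Fin n) K 1) := by
  rw [← Submodule.mem_comap]
  refine (iSup₂_le fun p hp => Submodule.map₂_le.2 fun x hx y hy => ?_ :
    degreeComponentPos2 K n m ≤ _) hσ
  rw [Submodule.mem_comap, TensorProduct.mk_apply, LinearMap.lTensor_tmul,
    homogeneousComponent_of_mem hy]
  split_ifs with h
  · rw [← h] at hy
    have hx' : x ∈ homogeneousSubmodule (Fin n) K (m - 1) := by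
      rwa [show m - 1 = p.1 by omega]
    exact Submodule.apply_mem_map₂ _ hx' hy
  · rw [TensorProduct.tmul_zero]
    exact zero_mem _

lemma lTensor_homogeneousComponent_eq_zero {K : Type*} [CommRing K] {n a b c : ℕ} (hbc : c ≠ b)
    {σ : MvPolynomial (Fin n) K ⊗[K] MvPolynomial (Fin n) K}
    (hσ : σ ∈ Submodule.map₂
      (TensorProduct.mk K (MvPolynomial (Fin n) K) (MvPolynomial (Fin n) K))
      (homogeneousSubmodule (Fin n) K a) (homogeneousSubmodule (Fin n) K b)) :
    (homogeneousComponent c).lTensor (MvPolynomial (Fin n) K) σ = 0 := by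
  rw [← LinearMap.mem_ker]
  refine Submodule.map₂_le.2 (fun x _ y hy => ?_) hσ
  rw [LinearMap.mem_ker, TensorProduct.mk_apply, LinearMap.lTensor_tmul,
    homogeneousComponent_of_mem hy, if_neg hbc, TensorProduct.tmul_zero]

/-- Let `g` be a finite-dimensional vector space (over a field of
characteristic `0`), `m ≥ 2`, and let
`σ ∈ S^m(g⊕g) ≅ ⊕_{a+b=m, a,b≥1} S^a(g) ⊗ S^b(g)` (trivial components for `a = 0` or
`b = 0`) satisfy `(Δ₀⊗id)(σ) = σ^{1,3} + σ^{2,3}` (i.e. `(d⊗id)(σ) = 0`) and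
`(id⊗Δ₀)(σ) = σ^{1,3} + σ^{1,2}` (i.e. `(id⊗d)(σ) = 0`).  Then
`σ ∈ g ⊗ S^{m-1}(g)` and `σ ∈ S^{m-1}(g) ⊗ g`; hence if `m ≥ 3`, `σ = 0`. -/
theorem biprimitive_component_vanishes
    (K : Type*) [Field K] [CharZero K] (n : ℕ) (m : ℕ) (hm : 2 ≤ m)
    (σ : MvPolynomial (Fin n) K ⊗[K] MvPolynomial (Fin n) K)
    (hσ : σ ∈ degreeComponentPos2 K n m)
    (h1 : dTensorId K n σ = 0) (h2 : idTensorD K n σ = 0) :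
    σ ∈ Submodule.map₂
        (TensorProduct.mk K (MvPolynomial (Fin n) K) (MvPolynomial (Fin n) K))
        (Submodule.span K (Set.range (X : Fin n → MvPolynomial (Fin n) K)))
        (homogeneousSubmodule (Fin n) K (m - 1)) ∧
    σ ∈ Submodule.map₂
        (TensorProduct.mk K (MvPolynomial (Fin n) K) (MvPolynomial (Fin n) K))
        (homogeneousSubmodule (Fin n) K (m - 1))
        (Submodule.span K (Set.range (X : Fin n → MvPolynomial (Fin n) K))) ∧
    (3 ≤ m → σ = 0) := by
  have hr := rTensor_homogeneousComponent_one_of_dTensorId_eq_zero h1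
  have hl := lTensor_homogeneousComponent_one_of_idTensorD_eq_zero h2
  have hr' := rTensor_homogeneousComponent_one_mem hσ
  have hl' := lTensor_homogeneousComponent_one_mem hσ
  rw [hr] at hr'
  rw [hl] at hl'
  rw [← homogeneousSubmodule_one_eq_span_X]
  refine ⟨hr', hl', fun h3 => ?_⟩
  rw [← hl]
  exact lTensor_homogeneousComponent_eq_zero (by omega) hr'
end
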